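/- Let A_a and A_b be graded normal even tensors (with respect to diagonal ±1 parities Z_a ∈ M_{D_a}(ℂ) and Z_b ∈ M_{D_b}(ℂ)) over the same physical index set {0,…,d−1} and parity function. Set c_a = 1 if A_a is non-degenerate and c_a = 2 if A_a is degenerate. Let F = Σ_i conj(A_b^i) ⊗ A_a^i, so that the overlap of the ABC fMPSs is ⟨V_b^{(N)}|V_a^{(N)}⟩ = tr(F^N). Then: (i) ⟨V_a^{(N)}|V_a^{(N)}⟩ = tr(E_{A_a}^N) converges to c_a as N → ∞; (ii) |tr(F^N)| converges as N → ∞ and its limit equals either 0 or c_a; (iii) if the limit is nonzero, then A_a and A_b are either both non-degenerate or both degenerate, D_a = D_b, and there exist φ ∈ ℝ, an invertible matrix X with X Z_a = Z_a X, and a permutation matrix Π with Π^{−1} Z_a Π = Z_b or Π^{−1} Z_a Π = −Z_b, such that A_a^i = e^{iφ} X Π A_b^i Π^{−1} X^{−1} for all i. -/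

import Mathlib

open Matrix Kronecker
open scoped ComplexOrder

namespace FQCA

noncomputable section

/-- The sign `(-1)^x` associated with a parity `x ∈ ℤ₂`. -/
def sgn (x : ZMod 2) : ℂ := (-1 : ℂ) ^ x.val

/-- Entrywise complex conjugation of a matrix. -/
def mconj {m n : Type*} (A : Matrix m n ℂ) : Matrix m n ℂ := A.map (starRingEnd ℂ)

/-- A diagonal matrix with diagonal entries `±1`. -/
def IsParityMatrix {ν : Type*} (Z : Matrix ν ν ℂ) : Prop :=
  Z.IsDiag ∧ ∀ α, Z α α = 1 ∨ Z α α = -1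

/-- An even tensor: `Z * A i = (-1)^{|i|} A i * Z`. -/
def EvenTensor {ι ν : Type*} [Fintype ν] (p : ι → ZMod 2)
    (A : ι → Matrix ν ν ℂ) (Z : Matrix ν ν ℂ) : Prop :=
  ∀ i, Z * A i = sgn (p i) • (A i * Z)

/-- The transfer matrix `E_A = Σ_i A^i ⊗ conj (A^i)`. -/
def transfer {ι ν : Type*} [Fintype ι] (A : ι → Matrix ν ν ℂ) :
    Matrix (ν × ν) (ν × ν) ℂ :=
  ∑ i, (A i) ⊗ₖ (mconj (A i))

/-- `P` is the orthogonal projector of a nonzero proper graded invariant subspace for `A`. -/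
def GradedInvariantProj {ι ν : Type*} [Fintype ν] [DecidableEq ν]
    (A : ι → Matrix ν ν ℂ) (Z P : Matrix ν ν ℂ) : Prop :=
  P * P = P ∧ Pᴴ = P ∧ P ≠ 0 ∧ P ≠ 1 ∧ P * Z = Z * P ∧ ∀ i, A i * P = P * (A i * P)

/-- A graded irreducible tensor: no nonzero proper graded invariant subspace. -/
def GradedIrreducible {ι ν : Type*} [Fintype ν] [DecidableEq ν]
    (A : ι → Matrix ν ν ℂ) (Z : Matrix ν ν ℂ) : Prop :=
  ¬ ∃ P, GradedInvariantProj A Z P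

/-- A graded normal tensor, `mult = 1` (non-degenerate) or `2` (degenerate):
graded irreducible, `1` is an eigenvalue of the transfer matrix of algebraic multiplicity
`mult`, and all other eigenvalues have modulus `< 1`. -/
def GradedNormal {ι ν : Type*} [Fintype ι] [Fintype ν] [DecidableEq ν]
    (A : ι → Matrix ν ν ℂ) (Z : Matrix ν ν ℂ) (mult : ℕ) : Prop :=
  GradedIrreducible A Z ∧
  (Matrix.charpoly (transfer A)).rootMultiplicity 1 = mult ∧
  ∀ μ ∈ spectrum ℂ (transfer A), μ ≠ 1 → ‖μ‖ < 1

/-- Graded Canonical Form: `A^i = ⊕ₖ μₖ Aₖ^i` with `Z` block diagonal in the same way and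
every block a graded normal tensor. -/
def GCF {ι ν : Type*} [Fintype ι] [Fintype ν] [DecidableEq ν]
    (p : ι → ZMod 2) (A : ι → Matrix ν ν ℂ) (Z : Matrix ν ν ℂ) : Prop :=
  ∃ (g : ℕ) (Dk : Fin g → ℕ) (e : ν ≃ ((k : Fin g) × Fin (Dk k)))
    (μ : Fin g → ℂ)
    (Ak : (k : Fin g) → ι → Matrix (Fin (Dk k)) (Fin (Dk k)) ℂ)
    (Zk : (k : Fin g) → Matrix (Fin (Dk k)) (Fin (Dk k)) ℂ),
    0 < g ∧
    (∀ i, Matrix.reindex e e (A i) = Matrix.blockDiagonal' (fun k => μ k • Ak k i)) ∧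
    Matrix.reindex e e Z = Matrix.blockDiagonal' Zk ∧
    ∀ k, IsParityMatrix (Zk k) ∧ EvenTensor p (Ak k) (Zk k) ∧
      (GradedNormal (Ak k) (Zk k) 1 ∨ GradedNormal (Ak k) (Zk k) 2)

/-- The coefficient `tr(A^{n₁} ⋯ A^{n_N})` of the fMPS with antiperiodic boundary
conditions generated by the tensor `A`. -/
def mpsCoeff {ι ν : Type*} [Fintype ν] [DecidableEq ν] {N : ℕ}
    (A : ι → Matrix ν ν ℂ) (n : Fin N → ι) : ℂ :=
  ((List.ofFn fun j => A (n j)).prod).trace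

/-- The fermionic sign `σ(n,m) = Σ_{k<j} (|n_j|+|m_j|)·|m_k|` of an fMPO matrix element. -/
def mpoSign {ι : Type*} (p : ι → ZMod 2) {N : ℕ} (n m : Fin N → ι) : ZMod 2 :=
  ∑ jk ∈ Finset.univ.filter (fun jk : Fin N × Fin N => jk.2 < jk.1),
    (p (n jk.1) + p (m jk.1)) * p (m jk.2)

/-- The fMPO with antiperiodic boundary conditions generated by the MPO tensor `U`. -/
def fMPO {ι : Type*} (p : ι → ZMod 2) {ν : Type*} [Fintype ν] [DecidableEq ν]
    (U : ι → ι → Matrix ν ν ℂ) (N : ℕ) :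
    Matrix (Fin N → ι) (Fin N → ι) ℂ :=
  Matrix.of fun n m =>
    sgn (mpoSign p n m) * ((List.ofFn fun j => U (n j) (m j)).prod).trace

/-- The fMPO with periodic boundary conditions generated by the MPO tensor `U`
(parity operator `Z` inserted in the trace). -/
def fMPO_PBC {ι : Type*} (p : ι → ZMod 2) {ν : Type*} [Fintype ν] [DecidableEq ν]
    (Z : Matrix ν ν ℂ) (U : ι → ι → Matrix ν ν ℂ) (N : ℕ) :
    Matrix (Fin N → ι) (Fin N → ι) ℂ :=
  Matrix.of fun n m =>
    sgn (mpoSign p n m) * (Z * (List.ofFn fun j => U (n j) (m j)).prod).trace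

/-- The fermionic blocking sign `τ(n,m) = Σ_{j<l} |m_j|·(|n_l|+|m_l|)`. -/
def blockSign {ι : Type*} (p : ι → ZMod 2) {q : ℕ} (n m : Fin q → ι) : ZMod 2 :=
  ∑ jl ∈ Finset.univ.filter (fun jl : Fin q × Fin q => jl.1 < jl.2),
    p (m jl.1) * (p (n jl.2) + p (m jl.2))

/-- The `q`-fold blocked MPO tensor, with the fermionic blocking signs. -/
def blocked {ι : Type*} (p : ι → ZMod 2) {ν : Type*} [Fintype ν] [DecidableEq ν]
    (U : ι → ι → Matrix ν ν ℂ) (q : ℕ) :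
    (Fin q → ι) → (Fin q → ι) → Matrix ν ν ℂ :=
  fun n m => sgn (blockSign p n m) • ((List.ofFn fun j => U (n j) (m j)).prod)

/-- The right rank `r(U)`: rank of the matrix with entry
`(-1)^{|n||m|} (U^{n,m})_{α,β}` in row `(n,β)` and column `(m,α)`. -/
def rightRank {ι ν : Type*} [Fintype ι] [Fintype ν]
    (p : ι → ZMod 2) (U : ι → ι → Matrix ν ν ℂ) : ℕ :=
  (Matrix.of fun (r c : ι × ν) => sgn (p r.1 * p c.1) * U r.1 c.1 c.2 r.2).rank

/-- The left rank `ℓ(U)`: rank of the matrix with entry `(U^{n,m})_{α,β}`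
in row `(n,α)` and column `(m,β)`. -/
def leftRank {ι ν : Type*} [Fintype ι] [Fintype ν]
    (U : ι → ι → Matrix ν ν ℂ) : ℕ :=
  (Matrix.of fun (r c : ι × ν) => U r.1 c.1 r.2 c.2).rank

/-- The Pauli matrix `σˣ`, indexed by `Bool`. -/
def pauliX : Matrix Bool Bool ℂ := Matrix.of fun a b => if a = b then 0 else 1

/-- The Pauli matrix `σᶻ`, indexed by `Bool`. -/
def pauliZ : Matrix Bool Bool ℂ := Matrix.diagonal (fun b => if b then -1 else 1)

/-- The single-site physical parity matrix `P = diag((-1)^{|i|})`. -/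
def singleP {ι : Type*} [DecidableEq ι] (p : ι → ZMod 2) : Matrix ι ι ℂ :=
  Matrix.diagonal (fun i => sgn (p i))

/-- The parity of the doubled physical index `(n,m)` of an MPO tensor. -/
def doubledP {ι : Type*} (p : ι → ZMod 2) : ι × ι → ZMod 2 :=
  fun nm => p nm.1 + p nm.2

/-- An MPO tensor regarded as a tensor in the doubled physical index. -/
def doubledT {ι ν : Type*} (U : ι → ι → Matrix ν ν ℂ) : ι × ι → Matrix ν ν ℂ :=
  fun nm => U nm.1 nm.2

/-- An MPO tensor rescaled by `c`, regarded as a tensor in the doubled physical index. -/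
def mpoScaled {ι ν : Type*} (c : ℂ) (U : ι → ι → Matrix ν ν ℂ) : ι × ι → Matrix ν ν ℂ :=
  fun nm => c • U nm.1 nm.2

/-- The parity operator `σᶻ ⊗ I` on the bond space `Bool × Fin b`. -/
def ZBP (b : ℕ) : Matrix (Bool × Fin b) (Bool × Fin b) ℂ :=
  pauliZ ⊗ₖ (1 : Matrix (Fin b) (Fin b) ℂ)

/-- Structure of a type II MPO tensor: `U^{n,m} = (σˣ)^{|n|+|m|} ⊗ N^{n,m}`. -/
def TypeIIStruct {d b : ℕ} (p : Fin d → ZMod 2)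
    (U : Fin d → Fin d → Matrix (Bool × Fin b) (Bool × Fin b) ℂ) : Prop :=
  ∃ Nm : Fin d → Fin d → Matrix (Fin b) (Fin b) ℂ,
    ∀ n m', U n m' = (pauliX ^ (p n + p m').val) ⊗ₖ Nm n m'

/-- The parity matrix of the product grading on `q` sites. -/
def bigP {d : ℕ} (p : Fin d → ZMod 2) (q : ℕ) :
    Matrix (Fin q → Fin d) (Fin q → Fin d) ℂ :=
  Matrix.diagonal (fun n => sgn (∑ i, p (n i)))

/-- The Jordan-Wigner embedding at site `j` of a local operator `O` homogeneous of
parity `o`: `P^{|O|} ⊗ ⋯ ⊗ P^{|O|} ⊗ O ⊗ I ⊗ ⋯ ⊗ I`. -/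
def jordanWigner {d N : ℕ} (p : Fin d → ZMod 2) (o : ZMod 2)
    (O : Matrix (Fin d) (Fin d) ℂ) (j : Fin N) :
    Matrix (Fin N → Fin d) (Fin N → Fin d) ℂ :=
  Matrix.of fun n m =>
    (∏ l ∈ Finset.univ.filter (fun l : Fin N => l < j),
      ((singleP p) ^ o.val) (n l) (m l)) *
    O (n j) (m j) *
    (∏ l ∈ Finset.univ.filter (fun l : Fin N => j < l),
      (if n l = m l then (1:ℂ) else 0))

/-- The mixed transfer matrix `F = Σ_i conj(A_b^i) ⊗ A_a^i`, whose powers give the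
overlaps of the two fMPSs with antiperiodic boundary conditions. -/
def overlapTM {d Da Db : ℕ} (Ab : Fin d → Matrix (Fin Db) (Fin Db) ℂ)
    (Aa : Fin d → Matrix (Fin Da) (Fin Da) ℂ) :
    Matrix (Fin Db × Fin Da) (Fin Db × Fin Da) ℂ :=
  ∑ i, (mconj (Ab i)) ⊗ₖ (Aa i)

/-- The determinant of `q(M)` is the product of the values of `q` at the eigenvalues of `M`. -/
theorem det_aeval_eq_prod_roots {n : Type*} [Fintype n] [DecidableEq n]
    (M : Matrix n n ℂ) (q : Polynomial ℂ) :
    (Polynomial.aeval M q).det = (M.charpoly.roots.map fun x => q.eval x).prod := by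
  have hcard : M.charpoly.roots.card = Fintype.card n := by
    rw [← M.charpoly_natDegree_eq_dim]
    exact (IsAlgClosed.splits M.charpoly).natDegree_eq_card_roots.symm
  have hlin (a : ℂ) : (Polynomial.aeval M (Polynomial.X - Polynomial.C a)).det =
      (M.charpoly.roots.map fun x => (Polynomial.X - Polynomial.C a).eval x).prod := by
    have h1 : Polynomial.aeval M (Polynomial.X - Polynomial.C a) = -(scalar n a - M) := by
      simp [Algebra.algebraMap_eq_smul_one, smul_one_eq_diagonal]
    have h2 : (scalar n a - M).det = (M.charpoly.roots.map fun x => a - x).prod := by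
      rw [← Matrix.eval_charpoly]
      conv_lhs => rw [(IsAlgClosed.splits M.charpoly).eq_prod_roots_of_monic M.charpoly_monic]
      rw [Polynomial.eval_multiset_prod, Multiset.map_map]
      simp
    have h3 : (fun x : ℂ => (Polynomial.X - Polynomial.C a).eval x) =
        fun x => (-1) * (a - x) := by
      funext x; simp
    rw [h1, det_neg, h2, h3, Multiset.prod_map_mul, Multiset.map_const', Multiset.prod_replicate,
      hcard]
  have hprod (s : Multiset ℂ) :
      (Polynomial.aeval M (s.map fun a => Polynomial.X - Polynomial.C a).prod).det =
      (M.charpoly.roots.map fun x =>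
        (s.map fun a => Polynomial.X - Polynomial.C a).prod.eval x).prod := by
    induction s using Multiset.induction with
    | empty => simp
    | cons a s ih =>
      simp only [Multiset.map_cons, Multiset.prod_cons, map_mul, det_mul, Polynomial.eval_mul,
        Multiset.prod_map_mul, ih, hlin]
  rw [(IsAlgClosed.splits q).eq_prod_roots, map_mul, det_mul, hprod]
  simp only [Polynomial.eval_mul, Multiset.prod_map_mul]
  congr 1
  simp [Algebra.algebraMap_eq_smul_one, hcard]

/-- The trace of a power of a complex matrix is the power sum of its eigenvalues. -/
theorem trace_pow_eq_sum_roots {n : Type*} [Fintype n] [DecidableEq n]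
    (M : Matrix n n ℂ) (N : ℕ) :
    (M ^ N).trace = (M.charpoly.roots.map fun x => x ^ N).sum := by
  have h : (M ^ N).charpoly =
      ((M.charpoly.roots.map fun x => x ^ N).map fun a =>
        Polynomial.X - Polynomial.C a).prod := by
    refine Polynomial.funext fun x => ?_
    have h1 : scalar n x - M ^ N =
        Polynomial.aeval M (Polynomial.C x - Polynomial.X ^ N) := by
      simp [Algebra.algebraMap_eq_smul_one, smul_one_eq_diagonal]
    rw [Matrix.eval_charpoly, h1, det_aeval_eq_prod_roots, Polynomial.eval_multiset_prod,
      Multiset.map_map, Multiset.map_map]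
    simp
  rw [trace_eq_sum_roots_charpoly, h, Polynomial.roots_multiset_prod_X_sub_C]

/-- If every eigenvalue of `M` is `1` or lies in the open unit disc, then `tr (M ^ N)` converges
to the algebraic multiplicity of the eigenvalue `1`. -/
theorem tendsto_trace_pow {n : Type*} [Fintype n] [DecidableEq n] (M : Matrix n n ℂ)
    (h : ∀ μ ∈ spectrum ℂ M, μ ≠ 1 → ‖μ‖ < 1) :
    Filter.Tendsto (fun N : ℕ => (M ^ N).trace) Filter.atTop
      (nhds (M.charpoly.rootMultiplicity 1 : ℂ)) := by
  have hsum : (M.charpoly.rootMultiplicity 1 : ℂ) =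
      (M.charpoly.roots.map fun x => if x = 1 then (1 : ℂ) else 0).sum := by
    rw [← Polynomial.count_roots]
    induction M.charpoly.roots using Multiset.induction with
    | empty => simp
    | cons a s ih =>
      rw [Multiset.map_cons, Multiset.sum_cons, ← ih, Multiset.count_cons]
      by_cases ha : a = 1
      · simp [ha, add_comm]
      · simp [ha, Ne.symm ha]
  rw [hsum]
  simp only [trace_pow_eq_sum_roots]
  refine tendsto_multiset_sum _ fun x hx => ?_
  by_cases hx1 : x = 1
  · exact tendsto_const_nhds.congr fun N => by simp [hx1]
  · simp only [hx1, if_false]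
    refine tendsto_pow_atTop_nhds_zero_of_norm_lt_one (h x ?_ hx1)
    exact mem_spectrum_iff_isRoot_charpoly.2 (Polynomial.isRoot_of_mem_roots hx)

/-- A matrix leaving a subspace invariant satisfies `M * P = P * (M * P)`, where `P` is the
orthogonal projector onto the subspace. -/
theorem exists_orthogonal_projector {n : Type*} [Fintype n] [DecidableEq n]
    (S : Submodule ℂ (n → ℂ)) :
    ∃ P : Matrix n n ℂ, P * P = P ∧ Pᴴ = P ∧ (P = 0 → S = ⊥) ∧ (P = 1 → S = ⊤) ∧
      ∀ M : Matrix n n ℂ, (∀ v ∈ S, M *ᵥ v ∈ S) → M * P = P * (M * P) := by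
  set S' : Submodule ℂ (EuclideanSpace ℂ n) :=
    S.comap (WithLp.linearEquiv 2 ℂ (n → ℂ)).toLinearMap with hS'
  have hmem (x : EuclideanSpace ℂ n) : x ∈ S' ↔ x.ofLp ∈ S := Iff.rfl
  set T := S'.starProjection with hT
  set φ := Matrix.toEuclideanCLM (n := n) (𝕜 := ℂ) with hφ
  have hφP : φ (φ.symm T) = T := φ.apply_symm_apply T
  refine ⟨φ.symm T, ?_, ?_, ?_, ?_, ?_⟩
  · apply EquivLike.injective φ
    rw [map_mul, hφP]
    exact S'.isIdempotentElem_starProjection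
  · apply EquivLike.injective φ
    rw [← star_eq_conjTranspose, map_star, hφP]
    exact (isSelfAdjoint_starProjection S').star_eq
  · intro h
    have hT0 : T = 0 := by rw [← hφP, h, map_zero]
    rw [eq_bot_iff]
    intro v hv
    have hv' : WithLp.toLp 2 v ∈ S' := hv
    have := Submodule.starProjection_eq_self_iff.2 hv'
    rw [← hT, hT0] at this
    simpa using (congrArg WithLp.ofLp this).symm
  · intro h
    have hT1 : T = 1 := by rw [← hφP, h, map_one]
    rw [eq_top_iff]
    intro v _
    have := S'.starProjection_apply_mem (WithLp.toLp 2 v)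
    rw [← hT, hT1] at this
    exact this
  · intro M hM
    apply EquivLike.injective φ
    rw [map_mul, map_mul, map_mul, hφP]
    ext1 x
    have : φ M (T x) ∈ S' := by
      rw [hmem, Matrix.ofLp_toEuclideanCLM]
      exact hM _ ((hmem _).1 (S'.starProjection_apply_mem x))
    exact (Submodule.starProjection_eq_self_iff.2 this).symm

theorem IsParityMatrix.eq_diagonal {n : Type*} [DecidableEq n] {Z : Matrix n n ℂ}
    (hZ : IsParityMatrix Z) : Z = diagonal fun i => Z i i :=
  hZ.1.diagonal_diag.symm

theorem IsParityMatrix.conjTranspose_eq {n : Type*} [DecidableEq n] {Z : Matrix n n ℂ}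
    (hZ : IsParityMatrix Z) : Zᴴ = Z := by
  rw [hZ.eq_diagonal, diagonal_conjTranspose]
  congr 1
  funext i
  rcases hZ.2 i with h | h <;> simp [h]

theorem IsParityMatrix.mul_self {n : Type*} [Fintype n] [DecidableEq n] {Z : Matrix n n ℂ}
    (hZ : IsParityMatrix Z) : Z * Z = 1 := by
  rw [hZ.eq_diagonal, diagonal_mul_diagonal, ← diagonal_one]
  congr 1
  funext i
  rcases hZ.2 i with h | h <;> simp [h]

theorem sgn_mul_self (x : ZMod 2) : sgn x * sgn x = 1 := by
  rw [sgn, ← mul_pow]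
  simp

theorem star_sgn (x : ZMod 2) : star (sgn x) = sgn x := by
  simp [sgn]

/-- A graded irreducible tensor has no nontrivial invariant graded subspace. -/
theorem GradedIrreducible.eq_bot_or_eq_top {ι n : Type*} [Fintype n] [DecidableEq n]
    {A : ι → Matrix n n ℂ} {Z : Matrix n n ℂ} (hA : GradedIrreducible A Z) (hZ : Zᴴ = Z)
    (S : Submodule ℂ (n → ℂ)) (hSA : ∀ i, ∀ v ∈ S, A i *ᵥ v ∈ S)
    (hSZ : ∀ v ∈ S, Z *ᵥ v ∈ S) : S = ⊥ ∨ S = ⊤ := by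
  obtain ⟨P, hPP, hPH, hP0, hP1, hinv⟩ := exists_orthogonal_projector S
  by_contra! hS
  refine hA ⟨P, hPP, hPH, fun h => hS.1 (hP0 h), fun h => hS.2 (hP1 h), ?_,
    fun i => hinv _ (hSA i)⟩
  have h1 := hinv Z hSZ
  have h2 := congrArg conjTranspose h1
  simp only [conjTranspose_mul, hPH, hZ] at h2
  rw [h2, h1, Matrix.mul_assoc]

theorem GradedIrreducible.conjTranspose {ι n : Type*} [Fintype n] [DecidableEq n]
    {A : ι → Matrix n n ℂ} {Z : Matrix n n ℂ} (hA : GradedIrreducible A Z) :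
    GradedIrreducible (fun i => (A i)ᴴ) Z := by
  rintro ⟨P, hPP, hPH, hP0, hP1, hPZ, hinv⟩
  refine hA ⟨1 - P, ?_, ?_, ?_, ?_, ?_, fun i => ?_⟩
  · simp [Matrix.mul_sub, Matrix.sub_mul, hPP]
  · simp [hPH]
  · rwa [sub_ne_zero, ne_comm]
  · simpa using hP0
  · simp [Matrix.mul_sub, Matrix.sub_mul, hPZ]
  · have h := congrArg Matrix.conjTranspose (hinv i)
    simp only [conjTranspose_mul, conjTranspose_conjTranspose, hPH] at h
    rw [Matrix.mul_assoc] at h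
    simp only [Matrix.mul_sub, Matrix.sub_mul, Matrix.mul_one, Matrix.one_mul]
    rw [← h]
    simp

theorem EvenTensor.conjTranspose {ι n : Type*} [Fintype n] {p : ι → ZMod 2}
    {A : ι → Matrix n n ℂ} {Z : Matrix n n ℂ} (hA : EvenTensor p A Z) (hZ : Zᴴ = Z) :
    EvenTensor p (fun i => (A i)ᴴ) Z := by
  intro i
  have h := congrArg Matrix.conjTranspose (hA i)
  simp only [conjTranspose_mul, conjTranspose_smul, hZ, star_sgn] at h
  rw [h, smul_smul, sgn_mul_self, one_smul]

theorem exists_eigenvector_of_mem_spectrum {n : Type*} [Fintype n] [DecidableEq n]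
    {M : Matrix n n ℂ} {μ : ℂ} (h : μ ∈ spectrum ℂ M) : ∃ v ≠ 0, M *ᵥ v = μ • v := by
  rw [spectrum.mem_iff, Matrix.isUnit_iff_isUnit_det, isUnit_iff_ne_zero, not_not,
    ← Matrix.exists_mulVec_eq_zero_iff] at h
  obtain ⟨v, hv, h⟩ := h
  refine ⟨v, hv, ?_⟩
  rw [Matrix.sub_mulVec, Algebra.algebraMap_eq_smul_one, smul_mulVec, one_mulVec, sub_eq_zero] at h
  exact h.symm

/-- In a complex Banach algebra, the powers of an element whose spectrum lies in the open unit
disc tend to zero. -/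
theorem tendsto_pow_zero_of_spectrum {𝔸 : Type*} [NormedRing 𝔸] [NormedAlgebra ℂ 𝔸]
    [CompleteSpace 𝔸] [Nontrivial 𝔸] (a : 𝔸) (h : ∀ μ ∈ spectrum ℂ a, ‖μ‖ < 1) :
    Filter.Tendsto (fun k : ℕ => a ^ k) Filter.atTop (nhds 0) := by
  have hr : spectralRadius ℂ a < (1 : NNReal) :=
    spectrum.spectralRadius_lt_of_forall_lt a fun z hz => h z hz
  obtain ⟨s, hs1, hs2⟩ := ENNReal.lt_iff_exists_nnreal_btwn.1 hr
  have hs2' : (s : ℝ) < 1 := by exact_mod_cast hs2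
  have hev := (spectrum.pow_nnnorm_pow_one_div_tendsto_nhds_spectralRadius a).eventually
    (gt_mem_nhds hs1)
  refine squeeze_zero_norm' ?_ (tendsto_pow_atTop_nhds_zero_of_lt_one s.2 hs2')
  filter_upwards [hev, Filter.eventually_gt_atTop 0] with k hk hk0
  have hk0' : (0 : ℝ) < k := by exact_mod_cast hk0
  have h1 : (‖a ^ k‖₊ : ENNReal) ≤ ((s ^ k : NNReal) : ENNReal) := by
    have := ENNReal.rpow_le_rpow hk.le hk0'.le
    rwa [← ENNReal.rpow_mul, one_div_mul_cancel hk0'.ne', ENNReal.rpow_one,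
      ENNReal.rpow_natCast, ← ENNReal.coe_pow] at this
  exact_mod_cast h1

/-- The inverse of `Matrix.vec`. -/
def unvec {m n : Type*} (v : n × m → ℂ) : Matrix m n ℂ := Matrix.of fun i j => v (j, i)

theorem vec_unvec {m n : Type*} (v : n × m → ℂ) : vec (unvec v) = v := rfl

theorem unvec_vec {m n : Type*} (X : Matrix m n ℂ) : unvec (vec X) = X := rfl

theorem isClosed_posSemidef {n : Type*} [Fintype n] :
    IsClosed {X : Matrix n n ℂ | X.PosSemidef} := by
  simp only [posSemidef_iff_dotProduct_mulVec, Set.ofPred_and, Set.ofPred_forall]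
  refine IsClosed.inter (isClosed_eq (by fun_prop) continuous_id)
    (isClosed_iInter fun v => isClosed_le continuous_const ?_)
  fun_prop

/-- A matrix acting on vectorized matrices is positive if it preserves positive semidefiniteness. -/
def IsPositiveMap {n : Type*} [Fintype n] (T : Matrix (n × n) (n × n) ℂ) : Prop :=
  ∀ X : Matrix n n ℂ, X.PosSemidef → (unvec (T *ᵥ vec X)).PosSemidef

section IsPositiveMap

variable {n : Type*} [Fintype n]

theorem IsPositiveMap.one [DecidableEq n] : IsPositiveMap (1 : Matrix (n × n) (n × n) ℂ) := by
  intro X hX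
  rwa [one_mulVec, unvec_vec]

theorem IsPositiveMap.mul {S T : Matrix (n × n) (n × n) ℂ} (hS : IsPositiveMap S)
    (hT : IsPositiveMap T) : IsPositiveMap (S * T) := by
  intro X hX
  rw [← mulVec_mulVec, ← vec_unvec (T *ᵥ vec X)]
  exact hS _ (hT X hX)

theorem IsPositiveMap.pow [DecidableEq n] {T : Matrix (n × n) (n × n) ℂ} (hT : IsPositiveMap T)
    (k : ℕ) : IsPositiveMap (T ^ k) := by
  induction k with
  | zero => simpa using IsPositiveMap.one
  | succ k ih => rw [pow_succ]; exact ih.mul hT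

theorem IsPositiveMap.smul {T : Matrix (n × n) (n × n) ℂ} (hT : IsPositiveMap T) {r : ℝ}
    (hr : 0 ≤ r) : IsPositiveMap ((r : ℂ) • T) := by
  intro X hX
  rw [smul_mulVec]
  exact (hT X hX).smul (by exact_mod_cast hr)

theorem IsPositiveMap.sum {ι : Type*} (s : Finset ι) {T : ι → Matrix (n × n) (n × n) ℂ}
    (hT : ∀ i ∈ s, IsPositiveMap (T i)) : IsPositiveMap (∑ i ∈ s, T i) := by
  intro X hX
  have : unvec ((∑ i ∈ s, T i) *ᵥ vec X) = ∑ i ∈ s, unvec (T i *ᵥ vec X) := by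
    ext i j
    simp [unvec, Matrix.sum_mulVec, Matrix.sum_apply]
  rw [this]
  exact posSemidef_sum s fun i hi => hT i hi X hX

theorem IsPositiveMap.of_tendsto {T : ℕ → Matrix (n × n) (n × n) ℂ}
    {L : Matrix (n × n) (n × n) ℂ} (hT : ∀ k, IsPositiveMap (T k))
    (h : Filter.Tendsto T Filter.atTop (nhds L)) : IsPositiveMap L := by
  intro X hX
  have hc : Continuous fun S : Matrix (n × n) (n × n) ℂ => unvec (S *ᵥ vec X) := by
    refine continuous_matrix fun i j => ?_
    simp only [unvec, Matrix.of_apply, mulVec, dotProduct]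
    fun_prop
  exact isClosed_posSemidef.mem_of_tendsto ((hc.tendsto L).comp h)
    (Filter.Eventually.of_forall fun k => hT k X hX)

end IsPositiveMap

/-- Every square matrix is a linear combination of positive semidefinite matrices. -/
theorem eq_sum_posSemidef {n : Type*} [Fintype n] [DecidableEq n] (X : Matrix n n ℂ) :
    X = (4⁻¹ : ℂ) • ((X + 1) * (X + 1)ᴴ - (X - 1) * (X - 1)ᴴ
      + Complex.I • ((X + Complex.I • 1) * (X + Complex.I • 1)ᴴ)
      - Complex.I • ((X - Complex.I • 1) * (X - Complex.I • 1)ᴴ)) := by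
  have hI : Complex.I * Complex.I = -1 := Complex.I_mul_I
  simp only [conjTranspose_add, conjTranspose_sub, conjTranspose_smul, conjTranspose_one,
    Matrix.add_mul, Matrix.mul_add, Matrix.sub_mul, Matrix.mul_sub, Matrix.mul_one,
    Matrix.one_mul, Complex.star_def, Complex.conj_I, Matrix.smul_mul, Matrix.mul_smul,
    smul_add, smul_sub, smul_smul, mul_neg, neg_mul, hI]
  module

section L2Operator

open scoped Matrix.Norms.L2Operator

variable {m : Type*} [Fintype m] [DecidableEq m]

/-- If `1` is an eigenvalue of maximal modulus, then `(1 - t M)⁻¹` exists for `0 < t < 1`, it is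
the limit of the partial Neumann sums, and its norm blows up as `t → 1`. -/
theorem neumann_inverse (M : Matrix m m ℂ) (h1 : (1 : ℂ) ∈ spectrum ℂ M)
    (hle : ∀ μ ∈ spectrum ℂ M, ‖μ‖ ≤ 1) {t : ℝ} (ht0 : 0 < t) (ht1 : t < 1) :
    ∃ R : Matrix m m ℂ, (t : ℂ) • (M * R) = R - 1 ∧ (1 - t)⁻¹ ≤ ‖R‖ ∧
      Filter.Tendsto (fun k : ℕ => ∑ j ∈ Finset.range k, ((t : ℂ) • M) ^ j)
        Filter.atTop (nhds R) := by
  obtain ⟨v, hv, hMv⟩ := exists_eigenvector_of_mem_spectrum h1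
  rw [one_smul] at hMv
  have hne : Nonempty m := by
    by_contra hm
    rw [not_nonempty_iff] at hm
    exact hv (Subsingleton.elim _ _)
  set B := (t : ℂ) • M with hB
  have htc : (t : ℂ) ≠ 0 := by exact_mod_cast ht0.ne'
  have hspec : ∀ μ ∈ spectrum ℂ B, ‖μ‖ < 1 := by
    intro μ hμ
    obtain ⟨w, hw, hBw⟩ := exists_eigenvector_of_mem_spectrum hμ
    have hmem : (t : ℂ)⁻¹ * μ ∈ spectrum ℂ M := by
      rw [spectrum.mem_iff, Matrix.isUnit_iff_isUnit_det, isUnit_iff_ne_zero, not_not,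
        ← Matrix.exists_mulVec_eq_zero_iff]
      refine ⟨w, hw, ?_⟩
      rw [hB, smul_mulVec] at hBw
      rw [Matrix.sub_mulVec, Algebra.algebraMap_eq_smul_one, smul_mulVec, one_mulVec, mul_smul,
        ← hBw, inv_smul_smul₀ htc, sub_self]
    have := hle _ hmem
    rw [norm_mul, norm_inv, Complex.norm_real, Real.norm_of_nonneg ht0.le,
      inv_mul_le_iff₀ ht0, mul_one] at this
    exact this.trans_lt ht1
  have hpow := tendsto_pow_zero_of_spectrum B hspec
  have hunit : IsUnit (1 - B) := by
    by_contra h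
    have : (1 : ℂ) ∈ spectrum ℂ B := by rwa [spectrum.mem_iff, map_one]
    simpa using hspec 1 this
  have hdet := (Matrix.isUnit_iff_isUnit_det _).1 hunit
  have hR := Matrix.mul_nonsing_inv _ hdet
  have hR' := Matrix.nonsing_inv_mul _ hdet
  set R := (1 - B)⁻¹
  have hgeom : ∀ k : ℕ, ∑ j ∈ Finset.range k, B ^ j = R * (1 - B ^ k) := fun k => by
    rw [← mul_neg_geom_sum B k, ← Matrix.mul_assoc, hR', Matrix.one_mul]
  refine ⟨R, ?_, ?_, ?_⟩
  · rw [← Matrix.smul_mul, ← hB, eq_sub_iff_add_eq', ← eq_sub_iff_add_eq, ← hR, Matrix.sub_mul,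
      Matrix.one_mul]
  · have hW : R * vecMulVec v v = ((1 - t : ℝ) : ℂ)⁻¹ • vecMulVec v v := by
      have hBW : (1 - B) * vecMulVec v v = ((1 - t : ℝ) : ℂ) • vecMulVec v v := by
        rw [Matrix.sub_mul, Matrix.one_mul, hB, Matrix.smul_mul, Matrix.mul_vecMulVec, hMv]
        push_cast
        rw [sub_smul, one_smul]
      have hne1 : ((1 - t : ℝ) : ℂ) ≠ 0 := by exact_mod_cast (sub_pos.2 ht1).ne'
      rw [eq_inv_smul_iff₀ hne1, ← Matrix.mul_smul, ← hBW, ← Matrix.mul_assoc, hR',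
        Matrix.one_mul]
    have hWpos : 0 < ‖vecMulVec v v‖ := by
      rw [norm_pos_iff]
      intro h
      apply hv
      funext i
      have := congrFun (congrFun h i) i
      simpa [vecMulVec_apply] using this
    have := norm_mul_le R (vecMulVec v v)
    rw [hW, norm_smul, norm_inv, Complex.norm_real,
      Real.norm_of_nonneg (sub_pos.2 ht1).le] at this
    exact le_of_mul_le_mul_right this hWpos
  · simp only [hgeom]
    have := (tendsto_const_nhds (x := R)).mul ((tendsto_const_nhds (x := 1)).sub hpow)
    simpa using this

/-- Perron–Frobenius: a positive map whose spectral radius is the eigenvalue `1` has a nonzero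
positive semidefinite fixed point. -/
theorem IsPositiveMap.exists_posSemidef_fixed {n : Type*} [Fintype n] [DecidableEq n]
    {M : Matrix (n × n) (n × n) ℂ} (hM : IsPositiveMap M) (h1 : (1 : ℂ) ∈ spectrum ℂ M)
    (hle : ∀ μ ∈ spectrum ℂ M, ‖μ‖ ≤ 1) :
    ∃ X : Matrix n n ℂ, X.PosSemidef ∧ X ≠ 0 ∧ M *ᵥ vec X = vec X := by
  obtain ⟨t, -, ht, htlim⟩ := exists_seq_strictMono_tendsto' (zero_lt_one' ℝ)
  choose R hR hRn hRlim using fun k => neumann_inverse M h1 hle (ht k).1 (ht k).2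
  have hpos (k : ℕ) : 0 < ‖R k‖ := (inv_pos.2 (sub_pos.2 (ht k).2)).trans_le (hRn k)
  have hRpos (k : ℕ) : IsPositiveMap (R k) :=
    IsPositiveMap.of_tendsto
      (fun j => IsPositiveMap.sum _ fun i _ => (hM.smul (ht k).1.le).pow i) (hRlim k)
  set Q : ℕ → Matrix (n × n) (n × n) ℂ := fun k => ((‖R k‖⁻¹ : ℝ) : ℂ) • R k with hQ
  have hQn (k : ℕ) : Q k ∈ Metric.sphere (0 : Matrix (n × n) (n × n) ℂ) 1 := by
    rw [mem_sphere_zero_iff_norm, hQ, norm_smul, Complex.norm_real,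
      Real.norm_of_nonneg (inv_nonneg.2 (hpos k).le), inv_mul_cancel₀ (hpos k).ne']
  have hproper : ProperSpace (Matrix (n × n) (n × n) ℂ) := FiniteDimensional.proper ℂ _
  obtain ⟨L, hL, φ, hφ, hφL⟩ := (isCompact_sphere _ _).tendsto_subseq hQn
  have hLpos : IsPositiveMap L :=
    IsPositiveMap.of_tendsto
      (fun k => (hRpos (φ k)).smul (inv_nonneg.2 (hpos (φ k)).le)) hφL
  have hinv : Filter.Tendsto (fun k => ((‖R k‖⁻¹ : ℝ) : ℂ)) Filter.atTop (nhds 0) := by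
    rw [← Complex.ofReal_zero]
    refine (Complex.continuous_ofReal.tendsto 0).comp ?_
    refine squeeze_zero (fun k => inv_nonneg.2 (hpos k).le)
      (fun k => inv_le_of_inv_le₀ (sub_pos.2 (ht k).2) (hRn k)) ?_
    simpa using htlim.const_sub 1
  have hML : M * L = L := by
    have e1 : Filter.Tendsto (fun k => (t (φ k) : ℂ) • (M * Q (φ k))) Filter.atTop
        (nhds (M * L)) := by
      have := ((Complex.continuous_ofReal.tendsto 1).comp (htlim.comp hφ.tendsto_atTop)).smul
        (hφL.const_mul M)
      simpa using this
    have e2 : Filter.Tendsto (fun k => (t (φ k) : ℂ) • (M * Q (φ k))) Filter.atTop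
        (nhds L) := by
      have := hφL.sub ((hinv.comp hφ.tendsto_atTop).smul_const (1 : Matrix (n × n) (n × n) ℂ))
      rw [zero_smul, sub_zero] at this
      refine this.congr fun k => ?_
      simp only [Function.comp_apply, hQ, Matrix.mul_smul]
      rw [smul_comm, hR, smul_sub]
    exact tendsto_nhds_unique e1 e2
  have hL0 : L ≠ 0 := by
    rintro rfl
    simp at hL
  have hex : ∃ X : Matrix n n ℂ, X.PosSemidef ∧ L *ᵥ vec X ≠ 0 := by
    by_contra! h
    apply hL0
    refine Matrix.ext_of_mulVec_single fun i => ?_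
    rw [zero_mulVec, ← vec_unvec (Pi.single i (1 : ℂ)),
      eq_sum_posSemidef (unvec (Pi.single i (1 : ℂ)))]
    simp only [vec_smul, vec_add, vec_sub, mulVec_smul, mulVec_add, mulVec_sub,
      h _ (posSemidef_self_mul_conjTranspose _), smul_zero, add_zero, sub_zero]
  obtain ⟨X, hX, hLX⟩ := hex
  refine ⟨unvec (L *ᵥ vec X), hLpos X hX, fun h => hLX ?_, ?_⟩
  · rw [← vec_unvec (L *ᵥ vec X), h, vec_zero]
  · rw [vec_unvec, mulVec_mulVec, hML]

end L2Operator

theorem overlapTM_mulVec_vec {d Da Db : ℕ} (Ab : Fin d → Matrix (Fin Db) (Fin Db) ℂ)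
    (Aa : Fin d → Matrix (Fin Da) (Fin Da) ℂ) (X : Matrix (Fin Da) (Fin Db) ℂ) :
    overlapTM Ab Aa *ᵥ vec X = vec (∑ i, Aa i * X * (Ab i)ᴴ) := by
  rw [overlapTM, sum_mulVec, vec_sum]
  exact Finset.sum_congr rfl fun i _ => kronecker_mulVec_vec _ _ _

theorem isPositiveMap_overlapTM {d D : ℕ} (A : Fin d → Matrix (Fin D) (Fin D) ℂ) :
    IsPositiveMap (overlapTM A A) := by
  intro X hX
  rw [overlapTM_mulVec_vec, unvec_vec]
  exact posSemidef_sum _ fun i _ => hX.mul_mul_conjTranspose_same (A i)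

theorem transfer_eq_reindex {d D : ℕ} (A : Fin d → Matrix (Fin D) (Fin D) ℂ) :
    transfer A = reindex (Equiv.prodComm _ _) (Equiv.prodComm _ _) (overlapTM A A) := by
  ext ⟨i, j⟩ ⟨k, l⟩
  simp [transfer, overlapTM, Matrix.sum_apply, kroneckerMap_apply, mul_comm]

theorem charpoly_transfer {d D : ℕ} (A : Fin d → Matrix (Fin D) (Fin D) ℂ) :
    (transfer A).charpoly = (overlapTM A A).charpoly := by
  rw [transfer_eq_reindex, charpoly_reindex]

theorem spectrum_transfer {d D : ℕ} (A : Fin d → Matrix (Fin D) (Fin D) ℂ) :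
    spectrum ℂ (transfer A) = spectrum ℂ (overlapTM A A) := by
  ext μ
  rw [mem_spectrum_iff_isRoot_charpoly, mem_spectrum_iff_isRoot_charpoly, charpoly_transfer]

theorem conjTranspose_overlapTM {d Da Db : ℕ} (Ab : Fin d → Matrix (Fin Db) (Fin Db) ℂ)
    (Aa : Fin d → Matrix (Fin Da) (Fin Da) ℂ) :
    (overlapTM Ab Aa)ᴴ = overlapTM (fun i => (Ab i)ᴴ) (fun i => (Aa i)ᴴ) := by
  rw [overlapTM, conjTranspose_sum]
  exact Finset.sum_congr rfl fun i _ => conjTranspose_kronecker _ _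

/-- The completely positive map of a graded irreducible tensor with spectral radius `1` has a
positive definite fixed point. -/
theorem exists_posDef_fixed {d D : ℕ} {p : Fin d → ZMod 2} {Z : Matrix (Fin D) (Fin D) ℂ}
    (hZ : IsParityMatrix Z) {A : Fin d → Matrix (Fin D) (Fin D) ℂ} (hA : EvenTensor p A Z)
    (hirr : GradedIrreducible A Z) (h1 : (1 : ℂ) ∈ spectrum ℂ (overlapTM A A))
    (hle : ∀ μ ∈ spectrum ℂ (overlapTM A A), ‖μ‖ ≤ 1) :
    ∃ ρ : Matrix (Fin D) (Fin D) ℂ, ρ.PosDef ∧ ∑ i, A i * ρ * (A i)ᴴ = ρ := by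
  obtain ⟨X, hX, hX0, hfix⟩ := (isPositiveMap_overlapTM A).exists_posSemidef_fixed h1 hle
  rw [overlapTM_mulVec_vec, vec_inj] at hfix
  have hZH := hZ.conjTranspose_eq
  have hZZ := hZ.mul_self
  have hX' : (Z * X * Z).PosSemidef := by
    have := hX.mul_mul_conjTranspose_same Z
    rwa [hZH] at this
  have hρ := hX.add hX'
  have hρfix : ∑ i, A i * (X + Z * X * Z) * (A i)ᴴ = X + Z * X * Z := by
    have h (i : Fin d) : A i * (Z * X * Z) * (A i)ᴴ = Z * (A i * X * (A i)ᴴ) * Z := by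
      have e1 : A i * Z = sgn (p i) • (Z * A i) := by
        rw [hA i, smul_smul, sgn_mul_self, one_smul]
      have e2 : Z * (A i)ᴴ = sgn (p i) • ((A i)ᴴ * Z) := hA.conjTranspose hZH i
      calc A i * (Z * X * Z) * (A i)ᴴ = (A i * Z) * X * (Z * (A i)ᴴ) := by
            simp only [Matrix.mul_assoc]
        _ = Z * (A i * X * (A i)ᴴ) * Z := by
            rw [e1, e2]
            simp only [Matrix.mul_assoc, Matrix.smul_mul, Matrix.mul_smul, smul_smul,
              sgn_mul_self, one_smul]
    simp only [Matrix.mul_add, Matrix.add_mul, Finset.sum_add_distrib, h]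
    rw [← Finset.sum_mul, ← Finset.mul_sum, hfix]
  have hρZ : (X + Z * X * Z) * Z = Z * (X + Z * X * Z) := by
    simp only [Matrix.mul_add, Matrix.add_mul, Matrix.mul_assoc, hZZ, Matrix.mul_one]
    rw [← Matrix.mul_assoc Z Z, hZZ, Matrix.one_mul, add_comm]
  have hρ0 : X + Z * X * Z ≠ 0 := by
    intro h
    have h2 := congrArg trace h
    rw [trace_add, trace_mul_comm, ← Matrix.mul_assoc, hZZ, Matrix.one_mul, trace_zero,
      ← two_mul] at h2
    exact hX0 (hX.trace_eq_zero_iff.1 (by simpa using h2))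
  set ρ := X + Z * X * Z
  refine ⟨ρ, ?_, hρfix⟩
  have hker := hirr.conjTranspose.eq_bot_or_eq_top hZH (LinearMap.ker ρ.mulVecLin) ?_ ?_
  · rcases hker with hker | hker
    · rw [hρ.posDef_iff_isUnit, ← mulVec_injective_iff_isUnit]
      exact LinearMap.ker_eq_bot.1 hker
    · exfalso
      apply hρ0
      refine Matrix.ext_of_mulVec_single fun i => ?_
      have : Pi.single i (1 : ℂ) ∈ LinearMap.ker ρ.mulVecLin := hker ▸ Submodule.mem_top
      rw [zero_mulVec]
      exact this
  · intro i v hv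
    rw [LinearMap.mem_ker, mulVecLin_apply] at hv ⊢
    rw [← hρ.dotProduct_mulVec_zero_iff]
    have hsum : ∑ j, star ((A j)ᴴ *ᵥ v) ⬝ᵥ (ρ *ᵥ ((A j)ᴴ *ᵥ v)) = 0 := by
      have : star v ⬝ᵥ (ρ *ᵥ v) = 0 := by rw [hv, dotProduct_zero]
      rw [← hρfix, sum_mulVec, dotProduct_sum] at this
      rw [← this]
      refine Finset.sum_congr rfl fun j _ => ?_
      rw [star_mulVec, conjTranspose_conjTranspose, ← dotProduct_mulVec, mulVec_mulVec,
        mulVec_mulVec, Matrix.mul_assoc]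
    exact (Finset.sum_eq_zero_iff_of_nonneg
      (fun j _ => hρ.dotProduct_mulVec_nonneg _)).1 hsum i (Finset.mem_univ i)
  · intro v hv
    rw [LinearMap.mem_ker, mulVecLin_apply] at hv ⊢
    rw [mulVec_mulVec, hρZ, ← mulVec_mulVec, hv, mulVec_zero]

theorem exists_isUnit_mul_conjTranspose {n : Type*} [Fintype n] [DecidableEq n]
    {ρ : Matrix n n ℂ} (hρ : ρ.PosDef) : ∃ C : Matrix n n ℂ, IsUnit C ∧ ρ = C * Cᴴ := by
  open scoped MatrixOrder in
  obtain ⟨C, hC⟩ := CStarAlgebra.nonneg_iff_eq_mul_star_self.mp hρ.posSemidef.nonneg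
  refine ⟨C, ?_, hC⟩
  have h := hρ.isUnit
  rw [hC, Matrix.isUnit_iff_isUnit_det, det_mul] at h
  exact (Matrix.isUnit_iff_isUnit_det _).2 (isUnit_of_mul_isUnit_left h)

/-- The form `D ↦ tr (σ D ρ Dᴴ)` is positive definite when `σ` and `ρ` are. -/
theorem trace_weighted_nonneg {m n : Type*} [Fintype m] [DecidableEq m] [Fintype n]
    [DecidableEq n] {σ : Matrix m m ℂ} {ρ : Matrix n n ℂ} (hσ : σ.PosDef) (hρ : ρ.PosDef)
    (D : Matrix m n ℂ) :
    0 ≤ (σ * (D * ρ * Dᴴ)).trace ∧ ((σ * (D * ρ * Dᴴ)).trace = 0 → D = 0) := by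
  obtain ⟨C, hC, rfl⟩ := exists_isUnit_mul_conjTranspose hσ
  obtain ⟨E, hE, rfl⟩ := exists_isUnit_mul_conjTranspose hρ
  have h : (C * Cᴴ * (D * (E * Eᴴ) * Dᴴ)).trace = ((Cᴴ * D * E) * (Cᴴ * D * E)ᴴ).trace := by
    rw [Matrix.mul_assoc, trace_mul_comm]
    simp only [conjTranspose_mul, conjTranspose_conjTranspose, Matrix.mul_assoc]
  rw [h, trace_mul_conjTranspose_self_eq_zero_iff]
  refine ⟨(posSemidef_self_mul_conjTranspose _).trace_nonneg, fun h0 => ?_⟩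
  have hC' : IsUnit (Cᴴ).det := (Matrix.isUnit_iff_isUnit_det _).1 hC.star
  have hE' := (Matrix.isUnit_iff_isUnit_det _).1 hE
  have h1 := congrArg (fun T => (Cᴴ)⁻¹ * T * E⁻¹) h0
  simpa only [Matrix.mul_assoc, Matrix.mul_nonsing_inv _ hE', Matrix.mul_one,
    Matrix.nonsing_inv_mul_cancel_left _ _ hC', Matrix.mul_zero, Matrix.zero_mul] using h1

/-- Eigenvectors of the mixed transfer map have eigenvalues in the closed unit disc, and those on
the unit circle give intertwiners. -/
theorem intertwiner_of_eigenvector {d Da Db : ℕ} {Ab : Fin d → Matrix (Fin Db) (Fin Db) ℂ}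
    {Aa : Fin d → Matrix (Fin Da) (Fin Da) ℂ} {ρ : Matrix (Fin Db) (Fin Db) ℂ}
    {σ : Matrix (Fin Da) (Fin Da) ℂ} (hρ : ρ.PosDef) (hσ : σ.PosDef)
    (hρfix : ∑ i, Ab i * ρ * (Ab i)ᴴ = ρ) (hσfix : ∑ i, (Aa i)ᴴ * σ * Aa i = σ)
    {Y : Matrix (Fin Da) (Fin Db) ℂ} (hY : Y ≠ 0) {μ : ℂ}
    (hμ : ∑ i, Aa i * Y * (Ab i)ᴴ = μ • Y) :
    ‖μ‖ ≤ 1 ∧ (‖μ‖ = 1 →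
      ∃ X : Matrix (Fin Da) (Fin Db) ℂ, X ≠ 0 ∧ ∀ i, Aa i * X = μ • (X * Ab i)) := by
  have hdet := (Matrix.isUnit_iff_isUnit_det _).1 hρ.isUnit
  obtain ⟨X, rfl⟩ : ∃ X, Y = X * ρ :=
    ⟨Y * ρ⁻¹, by rw [Matrix.mul_assoc, Matrix.nonsing_inv_mul _ hdet, Matrix.mul_one]⟩
  have hX : X ≠ 0 := by rintro rfl; simp at hY
  have hρH : ρᴴ = ρ := hρ.isHermitian
  have hμ' : ∑ i, Ab i * ρ * Xᴴ * (Aa i)ᴴ = star μ • (ρ * Xᴴ) := by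
    have := congrArg Matrix.conjTranspose hμ
    simpa only [conjTranspose_sum, conjTranspose_smul, conjTranspose_mul,
      conjTranspose_conjTranspose, hρH, ← Matrix.mul_assoc] using this
  set D : Fin d → Matrix (Fin Da) (Fin Db) ℂ := fun i => Aa i * X - μ • (X * Ab i) with hD
  have hsum : ∑ i, D i * ρ * (D i)ᴴ =
      ∑ i, Aa i * (X * ρ * Xᴴ) * (Aa i)ᴴ - (μ * star μ) • (X * ρ * Xᴴ) := by
    have e (i : Fin d) : D i * ρ * (D i)ᴴ = Aa i * (X * ρ * Xᴴ) * (Aa i)ᴴ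
        - star μ • ((Aa i * (X * ρ) * (Ab i)ᴴ) * Xᴴ)
        - μ • (X * (Ab i * ρ * Xᴴ * (Aa i)ᴴ))
        + (μ * star μ) • (X * (Ab i * ρ * (Ab i)ᴴ) * Xᴴ) := by
      simp only [hD, conjTranspose_sub, conjTranspose_smul, conjTranspose_mul, Matrix.sub_mul,
        Matrix.mul_sub, Matrix.smul_mul, Matrix.mul_smul, Matrix.mul_assoc]
      module
    simp only [e, Finset.sum_add_distrib, Finset.sum_sub_distrib, ← Finset.smul_sum,
      ← Matrix.sum_mul, ← Matrix.mul_sum, hμ, hμ', hρfix]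
    simp only [Matrix.smul_mul, Matrix.mul_smul, Matrix.mul_assoc]
    module
  have htr : ∑ i, (σ * (D i * ρ * (D i)ᴴ)).trace =
      (1 - μ * star μ) * (σ * (X * ρ * Xᴴ)).trace := by
    rw [← trace_sum, ← Finset.mul_sum, hsum, Matrix.mul_sub, trace_sub, Matrix.mul_smul,
      trace_smul, Finset.mul_sum, trace_sum]
    have e (i : Fin d) : (σ * (Aa i * (X * ρ * Xᴴ) * (Aa i)ᴴ)).trace =
        ((Aa i)ᴴ * σ * Aa i * (X * ρ * Xᴴ)).trace := by
      rw [← Matrix.mul_assoc, trace_mul_comm]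
      simp only [Matrix.mul_assoc]
    simp only [e]
    rw [← trace_sum, ← Finset.sum_mul, hσfix, smul_eq_mul, sub_mul, one_mul]
  have hnn (i : Fin d) := trace_weighted_nonneg hσ hρ (D i)
  have hXpos : 0 < (σ * (X * ρ * Xᴴ)).trace := by
    obtain ⟨h1, h2⟩ := trace_weighted_nonneg hσ hρ X
    exact lt_of_le_of_ne h1 fun h => hX (h2 h.symm)
  have hμn : μ * star μ = ((‖μ‖ ^ 2 : ℝ) : ℂ) := by
    rw [Complex.star_def, Complex.mul_conj, Complex.normSq_eq_norm_sq]
  refine ⟨?_, fun h1 => ⟨X, hX, fun i => ?_⟩⟩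
  · have hge : 0 ≤ (1 - μ * star μ) * (σ * (X * ρ * Xᴴ)).trace :=
      htr ▸ Finset.sum_nonneg fun i _ => (hnn i).1
    rw [hμn, ← Complex.ofReal_one, ← Complex.ofReal_sub] at hge
    have h3 := (Complex.le_def.1 hge).1
    rw [Complex.re_ofReal_mul, Complex.zero_re] at h3
    have h4 := nonneg_of_mul_nonneg_left h3 (Complex.lt_def.1 hXpos).1
    nlinarith [norm_nonneg μ]
  · rw [hμn, h1] at htr
    have h0 : ∑ i, (σ * (D i * ρ * (D i)ᴴ)).trace = 0 := by rw [htr]; simp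
    have := (Finset.sum_eq_zero_iff_of_nonneg (fun j _ => (hnn j).1)).1 h0 i (Finset.mem_univ i)
    exact sub_eq_zero.1 ((hnn i).2 this)

/-- A nonzero intertwiner of even tensors has a nonzero component of definite parity. -/
theorem exists_homogeneous_intertwiner {ι m n : Type*} [Fintype m] [DecidableEq m] [Fintype n]
    [DecidableEq n] {p : ι → ZMod 2} {Za : Matrix m m ℂ} (hZa : IsParityMatrix Za)
    {Aa : ι → Matrix m m ℂ} (hAa : EvenTensor p Aa Za) {Zb : Matrix n n ℂ}
    (hZb : IsParityMatrix Zb) {Ab : ι → Matrix n n ℂ} (hAb : EvenTensor p Ab Zb)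
    {X : Matrix m n ℂ} (hX0 : X ≠ 0) {μ : ℂ} (hX : ∀ i, Aa i * X = μ • (X * Ab i)) :
    ∃ (Y : Matrix m n ℂ) (ε : ℂ), Y ≠ 0 ∧ (ε = 1 ∨ ε = -1) ∧ Za * Y = ε • (Y * Zb) ∧
      ∀ i, Aa i * Y = μ • (Y * Ab i) := by
  have hW (i : ι) : Aa i * (Za * X * Zb) = μ • (Za * X * Zb * Ab i) := by
    have h1 : Aa i * Za = sgn (p i) • (Za * Aa i) := by
      rw [hAa i, smul_smul, sgn_mul_self, one_smul]
    calc Aa i * (Za * X * Zb) = (Aa i * Za) * X * Zb := by simp only [Matrix.mul_assoc]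
      _ = sgn (p i) • (Za * (Aa i * X) * Zb) := by
          rw [h1]; simp only [Matrix.smul_mul, Matrix.mul_assoc]
      _ = μ • (Za * X * (sgn (p i) • (Ab i * Zb))) := by
          rw [hX i]
          simp only [Matrix.smul_mul, Matrix.mul_smul, Matrix.mul_assoc, smul_comm μ]
      _ = μ • (Za * X * Zb * Ab i) := by rw [← hAb i, ← Matrix.mul_assoc]
  have hL (T : Matrix m n ℂ) : Za * (Za * T) = T := by
    rw [← Matrix.mul_assoc, hZa.mul_self, Matrix.one_mul]
  have hR (T : Matrix m n ℂ) : T * Zb * Zb = T := by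
    rw [Matrix.mul_assoc, hZb.mul_self, Matrix.mul_one]
  by_cases h : X + Za * X * Zb = 0
  · refine ⟨X - Za * X * Zb, -1, fun h' => hX0 ?_, Or.inr rfl, ?_, fun i => ?_⟩
    · have h2 := congrArg₂ (· + ·) h h'
      simp only [add_add_sub_cancel, add_zero, ← two_smul ℂ X] at h2
      exact (smul_eq_zero.1 h2).resolve_left two_ne_zero
    · rw [Matrix.mul_sub, Matrix.sub_mul, hR, Matrix.mul_assoc, hL]
      simp
    · rw [Matrix.mul_sub, Matrix.sub_mul, smul_sub, hX, hW]
  · refine ⟨X + Za * X * Zb, 1, h, Or.inl rfl, ?_, fun i => ?_⟩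
    · rw [Matrix.mul_add, Matrix.add_mul, hR, Matrix.mul_assoc, hL, one_smul, add_comm]
    · rw [Matrix.mul_add, Matrix.add_mul, smul_add, hX, hW]

/-- Schur's lemma for graded irreducible tensors. -/
theorem bijective_of_intertwiner {ι m n : Type*} [Fintype m] [DecidableEq m] [Fintype n]
    [DecidableEq n] {Za : Matrix m m ℂ} (hZa : IsParityMatrix Za)
    {Aa : ι → Matrix m m ℂ} (hirra : GradedIrreducible Aa Za) {Zb : Matrix n n ℂ}
    (hZb : IsParityMatrix Zb) {Ab : ι → Matrix n n ℂ} (hirrb : GradedIrreducible Ab Zb)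
    {Y : Matrix m n ℂ} (hY0 : Y ≠ 0) {ε : ℂ} (hε : ε ≠ 0) (hYZ : Za * Y = ε • (Y * Zb)) {μ : ℂ}
    (hμ : μ ≠ 0) (hY : ∀ i, Aa i * Y = μ • (Y * Ab i)) : Function.Bijective Y.mulVecLin := by
  have key {c : ℂ} (hc : c ≠ 0) {M : Matrix m m ℂ} {N : Matrix n n ℂ}
      (h : M * Y = c • (Y * N)) (v : n → ℂ) : M *ᵥ (Y *ᵥ v) = c • (Y *ᵥ (N *ᵥ v)) := by
    rw [mulVec_mulVec, h, smul_mulVec, mulVec_mulVec]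
  have hker {c : ℂ} (hc : c ≠ 0) {M : Matrix m m ℂ} {N : Matrix n n ℂ}
      (h : M * Y = c • (Y * N)) (v : n → ℂ) (hv : v ∈ LinearMap.ker Y.mulVecLin) :
      N *ᵥ v ∈ LinearMap.ker Y.mulVecLin := by
    rw [LinearMap.mem_ker, mulVecLin_apply] at hv ⊢
    have h1 := key hc h v
    rw [hv, mulVec_zero] at h1
    exact (smul_eq_zero.1 h1.symm).resolve_left hc
  have hrange {c : ℂ} (hc : c ≠ 0) {M : Matrix m m ℂ} {N : Matrix n n ℂ}
      (h : M * Y = c • (Y * N)) (w : m → ℂ) (hw : w ∈ LinearMap.range Y.mulVecLin) :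
      M *ᵥ w ∈ LinearMap.range Y.mulVecLin := by
    obtain ⟨v, rfl⟩ := hw
    exact ⟨c • N *ᵥ v, by
      rw [mulVecLin_apply, mulVecLin_apply, key hc h, mulVec_smul]⟩
  have hY0' (h : ∀ v, Y *ᵥ v = 0) : False :=
    hY0 (Matrix.ext_of_mulVec_single fun i => by rw [h, zero_mulVec])
  constructor
  · rcases hirrb.eq_bot_or_eq_top hZb.conjTranspose_eq _ (fun i => hker hμ (hY i))
      (hker hε hYZ) with h | h
    · exact LinearMap.ker_eq_bot.1 h
    · exact (hY0' fun v => LinearMap.mem_ker.1 (h ▸ Submodule.mem_top)).elim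
  · rcases hirra.eq_bot_or_eq_top hZa.conjTranspose_eq _ (fun i => hrange hμ (hY i))
      (hrange hε hYZ) with h | h
    · exact (hY0' fun v => LinearMap.congr_fun (LinearMap.range_eq_bot.1 h) v).elim
    · exact LinearMap.range_eq_top.1 h

theorem card_eq_of_bijective_mulVecLin {m n : Type*} [Fintype m] [Fintype n]
    {Y : Matrix m n ℂ} (hY : Function.Bijective Y.mulVecLin) : Fintype.card m = Fintype.card n := by
  simpa using (LinearEquiv.ofBijective _ hY).finrank_eq.symm

/-- Similar diagonal matrices differ by a permutation of the diagonal. -/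
theorem exists_perm_of_intertwined_diagonal {n K : Type*} [Fintype n] [DecidableEq n] [Field K]
    {f g : n → K} {Y : Matrix n n K} (hY : IsUnit Y)
    (h : diagonal f * Y = Y * diagonal g) : ∃ π : Equiv.Perm n, ∀ i, g (π i) = f i := by
  classical
  have hroots : Finset.univ.val.map f = Finset.univ.val.map g := by
    have h1 : (diagonal f).charpoly = (diagonal g).charpoly := by
      obtain ⟨U, rfl⟩ := hY
      rw [← charpoly_units_conj U (diagonal g), ← h, Matrix.mul_assoc]
      simp
    rw [charpoly_diagonal, charpoly_diagonal] at h1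
    have h2 (u : n → K) : (∏ i, (Polynomial.X - Polynomial.C (u i))).roots =
        Finset.univ.val.map u := by
      rw [← Polynomial.roots_multiset_prod_X_sub_C (Finset.univ.val.map u), Multiset.map_map]
      rfl
    rw [← h2 f, h1, h2 g]
  have hcard (c : K) : Fintype.card {i // f i = c} = Fintype.card {i // g i = c} := by
    have h3 (u : n → K) : Fintype.card {i // u i = c} = (Finset.univ.val.map u).count c := by
      rw [Fintype.card_subtype, Multiset.count_map, Finset.card_def, Finset.filter_val]
      simp only [eq_comm]
    rw [h3, h3, hroots]
  exact ⟨Equiv.ofFiberEquiv fun c => Fintype.equivOfCardEq (hcard c),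
    fun i => Equiv.ofFiberEquiv_map _ i⟩

theorem diagonal_mul_permMatrix {n K : Type*} [Fintype n] [DecidableEq n] [CommRing K]
    {f g : n → K} {π : Equiv.Perm n} (h : ∀ i, g (π i) = f i) :
    diagonal f * π.permMatrix K = π.permMatrix K * diagonal g := by
  ext i j
  rw [diagonal_mul, mul_diagonal]
  by_cases hij : π i = j
  · rw [← hij, h, mul_comm]
  · simp [Equiv.Perm.permMatrix, PEquiv.toMatrix_apply, hij]

theorem isUnit_permMatrix {n K : Type*} [Fintype n] [DecidableEq n] [CommRing K]
    (π : Equiv.Perm n) : IsUnit (π.permMatrix K) := by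
  rw [Matrix.isUnit_iff_isUnit_det, det_permutation]
  exact (Units.isUnit _).map (Int.castRingHom K)

theorem trace_units_conj_pow {n : Type*} [Fintype n] [DecidableEq n] (U : (Matrix n n ℂ)ˣ)
    (M : Matrix n n ℂ) (N : ℕ) : ((U.val * M * U⁻¹.val) ^ N).trace = (M ^ N).trace := by
  rw [Units.conj_pow, trace_mul_comm, ← Matrix.mul_assoc]
  simp

theorem mconj_conj_smul {n : Type*} [Fintype n] [DecidableEq n] (c : ℂ) (P Q R : Matrix n n ℂ) :
    mconj (c • (P * Q * R)) = star c • (mconj P * mconj Q * mconj R) := by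
  ext i j
  simp [mconj, Matrix.mul_apply]

theorem mconj_mul {n : Type*} [Fintype n] (P Q : Matrix n n ℂ) :
    mconj (P * Q) = mconj P * mconj Q := Matrix.map_mul

theorem mconj_one {n : Type*} [DecidableEq n] : mconj (1 : Matrix n n ℂ) = 1 :=
  Matrix.map_one _ (map_zero _) (map_one _)

/-- A gauge transformation of the ket tensor conjugates the mixed transfer matrix. -/
theorem overlapTM_of_gauge {d D : ℕ} {A B : Fin d → Matrix (Fin D) (Fin D) ℂ} {μ : ℂ}
    (U : (Matrix (Fin D) (Fin D) ℂ)ˣ) (h : ∀ i, A i = μ • (U.val * B i * U⁻¹.val)) :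
    ∃ V : (Matrix (Fin D × Fin D) (Fin D × Fin D) ℂ)ˣ,
      overlapTM B A = μ • (V.val * overlapTM B B * V⁻¹.val) := by
  refine ⟨⟨1 ⊗ₖ U.val, 1 ⊗ₖ U⁻¹.val, ?_, ?_⟩, ?_⟩
  · rw [← mul_kronecker_mul, Units.mul_inv, Matrix.one_mul, one_kronecker_one]
  · rw [← mul_kronecker_mul, Units.inv_mul, Matrix.one_mul, one_kronecker_one]
  · simp only [overlapTM, Units.inv_mk, Matrix.mul_sum, Matrix.sum_mul, Finset.smul_sum]
    refine Finset.sum_congr rfl fun i _ => ?_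
    rw [← mul_kronecker_mul, ← mul_kronecker_mul, Matrix.one_mul, Matrix.mul_one, h i,
      kronecker_smul]

/-- Gauge-equivalent tensors have transfer matrices with the same characteristic polynomial. -/
theorem charpoly_overlapTM_of_gauge {d D : ℕ} {A B : Fin d → Matrix (Fin D) (Fin D) ℂ} {μ : ℂ}
    (hμ : ‖μ‖ = 1) (U : (Matrix (Fin D) (Fin D) ℂ)ˣ)
    (h : ∀ i, A i = μ • (U.val * B i * U⁻¹.val)) :
    (overlapTM A A).charpoly = (overlapTM B B).charpoly := by
  have hμ' : star μ * μ = 1 := by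
    rw [Complex.star_def, mul_comm, Complex.mul_conj, Complex.normSq_eq_norm_sq, hμ]
    simp
  let V : (Matrix (Fin D × Fin D) (Fin D × Fin D) ℂ)ˣ :=
    ⟨mconj U.val ⊗ₖ U.val, mconj U⁻¹.val ⊗ₖ U⁻¹.val, by
      rw [← mul_kronecker_mul, ← mconj_mul, Units.mul_inv, mconj_one, one_kronecker_one], by
      rw [← mul_kronecker_mul, ← mconj_mul, Units.inv_mul, mconj_one, one_kronecker_one]⟩
  have hV : overlapTM A A = V.val * overlapTM B B * V⁻¹.val := by
    simp only [overlapTM, V, Units.inv_mk, Matrix.mul_sum, Matrix.sum_mul]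
    refine Finset.sum_congr rfl fun i _ => ?_
    rw [← mul_kronecker_mul, ← mul_kronecker_mul, h i, kronecker_smul, mconj_conj_smul,
      smul_kronecker, smul_smul, mul_comm, hμ', one_smul]
  rw [hV, coe_units_inv, charpoly_units_conj]

theorem spectrum_conjTranspose {n : Type*} [Fintype n] [DecidableEq n] (M : Matrix n n ℂ) (μ : ℂ) :
    μ ∈ spectrum ℂ Mᴴ ↔ star μ ∈ spectrum ℂ M := by
  rw [← Matrix.star_eq_conjTranspose, spectrum.map_star, Set.mem_star]

theorem one_mem_spectrum_of_rootMultiplicity {n : Type*} [Fintype n] [DecidableEq n]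
    {M : Matrix n n ℂ} (h : M.charpoly.rootMultiplicity 1 ≠ 0) : (1 : ℂ) ∈ spectrum ℂ M := by
  rw [mem_spectrum_iff_isRoot_charpoly]
  exact (Polynomial.rootMultiplicity_pos M.charpoly_monic.ne_zero).1 (Nat.pos_of_ne_zero h)

theorem GradedNormal.spectrum_overlapTM {d D : ℕ} {A : Fin d → Matrix (Fin D) (Fin D) ℂ}
    {Z : Matrix (Fin D) (Fin D) ℂ} {k : ℕ} (hA : GradedNormal A Z k) (hk : k ≠ 0) :
    (1 : ℂ) ∈ spectrum ℂ (overlapTM A A) ∧ ∀ μ ∈ spectrum ℂ (overlapTM A A), ‖μ‖ ≤ 1 := by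
  rw [← spectrum_transfer]
  refine ⟨one_mem_spectrum_of_rootMultiplicity (hA.2.1 ▸ hk), fun μ hμ => ?_⟩
  by_cases h : μ = 1
  · simp [h]
  · exact (hA.2.2 μ hμ h).le

theorem GradedNormal.tendsto_trace_pow {d D : ℕ} {A : Fin d → Matrix (Fin D) (Fin D) ℂ}
    {Z : Matrix (Fin D) (Fin D) ℂ} {k : ℕ} (hA : GradedNormal A Z k) :
    Filter.Tendsto (fun N : ℕ => ((transfer A) ^ N).trace) Filter.atTop (nhds (k : ℂ)) := by
  rw [← hA.2.1]
  exact FQCA.tendsto_trace_pow _ hA.2.2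

/-- Either the mixed transfer matrix of two graded normal tensors has spectral radius less than
`1`, or the tensors are intertwined up to a phase. -/
theorem spectrum_lt_one_or_exists_intertwiner {d Da Db : ℕ} {p : Fin d → ZMod 2}
    {Za : Matrix (Fin Da) (Fin Da) ℂ} (hZa : IsParityMatrix Za)
    {Zb : Matrix (Fin Db) (Fin Db) ℂ} (hZb : IsParityMatrix Zb)
    {Aa : Fin d → Matrix (Fin Da) (Fin Da) ℂ} (hAa : EvenTensor p Aa Za)
    {Ab : Fin d → Matrix (Fin Db) (Fin Db) ℂ} (hAb : EvenTensor p Ab Zb) {ka kb : ℕ}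
    (hka : ka ≠ 0) (hkb : kb ≠ 0) (hGa : GradedNormal Aa Za ka) (hGb : GradedNormal Ab Zb kb) :
    (∀ μ ∈ spectrum ℂ (overlapTM Ab Aa), ‖μ‖ < 1) ∨
      ∃ (μ : ℂ) (Y : Matrix (Fin Da) (Fin Db) ℂ) (ε : ℂ), ‖μ‖ = 1 ∧
        Function.Bijective Y.mulVecLin ∧ (ε = 1 ∨ ε = -1) ∧ Za * Y = ε • (Y * Zb) ∧
        ∀ i, Aa i * Y = μ • (Y * Ab i) := by
  obtain ⟨hb1, hble⟩ := hGb.spectrum_overlapTM hkb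
  obtain ⟨ha1, hale⟩ := hGa.spectrum_overlapTM hka
  obtain ⟨ρ, hρ, hρfix⟩ := exists_posDef_fixed hZb hAb hGb.1 hb1 hble
  obtain ⟨σ, hσ, hσfix⟩ := exists_posDef_fixed hZa (hAa.conjTranspose hZa.conjTranspose_eq)
    hGa.1.conjTranspose
    (by rwa [← conjTranspose_overlapTM, spectrum_conjTranspose, star_one])
    (fun μ hμ => by
      rw [← conjTranspose_overlapTM, spectrum_conjTranspose] at hμ
      simpa using hale _ hμ)
  simp only [conjTranspose_conjTranspose] at hσfix
  by_contra! h
  obtain ⟨⟨μ, hμ, hμ1⟩, hno⟩ := h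
  obtain ⟨v, hv, hFv⟩ := exists_eigenvector_of_mem_spectrum hμ
  have hfix : ∑ i, Aa i * unvec v * (Ab i)ᴴ = μ • unvec v := by
    have := overlapTM_mulVec_vec Ab Aa (unvec v)
    rw [vec_unvec, hFv] at this
    rw [← vec_inj, ← this]
    rfl
  have hv' : unvec v ≠ 0 := fun h => hv (by rw [← vec_unvec v, h]; rfl)
  obtain ⟨hle, hX⟩ := intertwiner_of_eigenvector hρ hσ hρfix hσfix hv' hfix
  have hμn : ‖μ‖ = 1 := le_antisymm hle hμ1
  have hμ0 : μ ≠ 0 := by rintro rfl; simp at hμn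
  obtain ⟨X, hX0, hX⟩ := hX hμn
  obtain ⟨Y, ε, hY0, hε, hYZ, hY⟩ := exists_homogeneous_intertwiner hZa hAa hZb hAb hX0 hX
  have hε0 : ε ≠ 0 := by rcases hε with rfl | rfl <;> simp
  obtain ⟨i, hi⟩ := hno μ Y ε hμn
    (bijective_of_intertwiner hZa hGa.1 hZb hGb.1 hY0 hε0 hYZ hμ0 hY) hε hYZ
  exact hi (hY i)

/-- A homogeneous invertible intertwiner of the parities factors through a permutation. -/
theorem exists_perm_factorization {D : ℕ} {Za Zb : Matrix (Fin D) (Fin D) ℂ}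
    (hZa : IsParityMatrix Za) (hZb : IsParityMatrix Zb) (U : (Matrix (Fin D) (Fin D) ℂ)ˣ) {ε : ℂ}
    (hU : Za * U.val = ε • (U.val * Zb)) :
    ∃ (X : Matrix (Fin D) (Fin D) ℂ) (π : Equiv.Perm (Fin D)), IsUnit X ∧ X * Za = Za * X ∧
      (π.permMatrix ℂ)⁻¹ * Za * π.permMatrix ℂ = ε • Zb ∧ X * π.permMatrix ℂ = U.val ∧
      (π.permMatrix ℂ)⁻¹ * X⁻¹ = U⁻¹.val := by
  have hda := hZa.eq_diagonal
  have hdb : ε • Zb = diagonal fun i => ε * Zb i i := by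
    conv_lhs => rw [hZb.eq_diagonal, ← diagonal_smul]
    rfl
  rw [← Matrix.mul_smul] at hU
  obtain ⟨π, hπ⟩ := exists_perm_of_intertwined_diagonal U.isUnit (f := fun i => Za i i)
    (g := fun i => ε * Zb i i) (by rw [← hda, ← hdb, hU])
  have hπZ : Za * π.permMatrix ℂ = π.permMatrix ℂ * (ε • Zb) := by
    rw [hda, hdb]
    exact diagonal_mul_permMatrix hπ
  obtain ⟨Q, hQ⟩ := isUnit_permMatrix (K := ℂ) π
  rw [← hQ] at hπZ
  refine ⟨(U * Q⁻¹).val, π, Units.isUnit _, ?_, ?_, ?_, ?_⟩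
  · have h1 : Q⁻¹.val * Za = ε • Zb * Q⁻¹.val := by
      rw [Units.inv_mul_eq_iff_eq_mul, ← Matrix.mul_assoc, ← hπZ, Units.mul_inv_cancel_right]
    rw [Units.val_mul, Matrix.mul_assoc, h1, ← Matrix.mul_assoc, ← hU, Matrix.mul_assoc]
  · rw [← hQ, ← coe_units_inv, Matrix.mul_assoc, hπZ, Units.inv_mul_cancel_left]
  · rw [← hQ, Units.val_mul, Units.inv_mul_cancel_right]
  · rw [← hQ, ← coe_units_inv, ← coe_units_inv, ← Units.val_mul]
    congr 1
    group

/-- Asymptotics of norms and overlaps of fMPSs generated by graded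
normal tensors, and the consequence of a non-vanishing limiting overlap. -/
theorem overlap_of_graded_normal {d Da Db : ℕ} (p : Fin d → ZMod 2)
    (Za : Matrix (Fin Da) (Fin Da) ℂ) (hZa : IsParityMatrix Za)
    (Zb : Matrix (Fin Db) (Fin Db) ℂ) (hZb : IsParityMatrix Zb)
    (Aa : Fin d → Matrix (Fin Da) (Fin Da) ℂ) (hAa : EvenTensor p Aa Za)
    (Ab : Fin d → Matrix (Fin Db) (Fin Db) ℂ) (hAb : EvenTensor p Ab Zb)
    (hGb : GradedNormal Ab Zb 1 ∨ GradedNormal Ab Zb 2)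
    (ca : ℝ)
    (hca : (GradedNormal Aa Za 1 ∧ ca = 1) ∨ (GradedNormal Aa Za 2 ∧ ca = 2)) :
    Filter.Tendsto (fun N : ℕ => ((transfer Aa) ^ N).trace)
      Filter.atTop (nhds (ca : ℂ)) ∧
    ∃ L : ℝ,
      Filter.Tendsto (fun N : ℕ => ‖((overlapTM Ab Aa) ^ N).trace‖)
        Filter.atTop (nhds L) ∧
      (L = 0 ∨ L = ca) ∧
      (L ≠ 0 →
        ((GradedNormal Aa Za 1 ∧ GradedNormal Ab Zb 1) ∨
          (GradedNormal Aa Za 2 ∧ GradedNormal Ab Zb 2)) ∧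
        ∃ h : Da = Db,
          ∃ (φ : ℝ) (X : Matrix (Fin Da) (Fin Da) ℂ) (π : Equiv.Perm (Fin Da)),
            IsUnit X ∧ X * Za = Za * X ∧
            ((π.permMatrix ℂ)⁻¹ * Za * (π.permMatrix ℂ) =
                Matrix.reindex (finCongr h).symm (finCongr h).symm Zb ∨
              (π.permMatrix ℂ)⁻¹ * Za * (π.permMatrix ℂ) =
                - Matrix.reindex (finCongr h).symm (finCongr h).symm Zb) ∧
            ∀ i, Aa i = Complex.exp ((φ : ℂ) * Complex.I) •
              (X * (π.permMatrix ℂ) *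
                (Matrix.reindex (finCongr h).symm (finCongr h).symm (Ab i)) *
                (π.permMatrix ℂ)⁻¹ * X⁻¹)) := by
  obtain ⟨ka, hka, hGa, hcak⟩ : ∃ k : ℕ, (k = 1 ∨ k = 2) ∧ GradedNormal Aa Za k ∧ ca = k := by
    rcases hca with ⟨h, rfl⟩ | ⟨h, rfl⟩
    · exact ⟨1, Or.inl rfl, h, by simp⟩
    · exact ⟨2, Or.inr rfl, h, by simp⟩
  obtain ⟨kb, hkb, hGb'⟩ : ∃ k : ℕ, (k = 1 ∨ k = 2) ∧ GradedNormal Ab Zb k := by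
    rcases hGb with h | h
    · exact ⟨1, Or.inl rfl, h⟩
    · exact ⟨2, Or.inr rfl, h⟩
  subst hcak
  refine ⟨by simpa using hGa.tendsto_trace_pow, ?_⟩
  rcases spectrum_lt_one_or_exists_intertwiner hZa hZb hAa hAb (by lia) (by lia) hGa hGb' with
    hlt | ⟨μ, Y, ε, hμ, hbij, hε, hYZ, hY⟩
  · have hroot : (overlapTM Ab Aa).charpoly.rootMultiplicity 1 = 0 := by
      by_contra hne
      simpa using hlt 1 (one_mem_spectrum_of_rootMultiplicity hne)
    refine ⟨0, ?_, Or.inl rfl, fun h => (h rfl).elim⟩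
    simpa [hroot] using (tendsto_trace_pow (overlapTM Ab Aa) fun ν hν _ => hlt ν hν).norm
  · have hD : Da = Db := by simpa using card_eq_of_bijective_mulVecLin hbij
    subst hD
    obtain ⟨U, rfl⟩ := mulVec_injective_iff_isUnit.1 hbij.1
    have hgauge (i : Fin d) : Aa i = μ • (U.val * Ab i * U⁻¹.val) := by
      rw [← Matrix.smul_mul, ← hY i, Units.mul_inv_cancel_right]
    have hchar := charpoly_overlapTM_of_gauge hμ U hgauge
    have hkk : ka = kb := by
      rw [← hGa.2.1, ← hGb'.2.1, charpoly_transfer, charpoly_transfer, hchar]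
    subst hkk
    obtain ⟨V, hV⟩ := overlapTM_of_gauge U hgauge
    have htr (N : ℕ) : ‖((overlapTM Ab Aa) ^ N).trace‖ = ‖((overlapTM Ab Ab) ^ N).trace‖ := by
      rw [hV, smul_pow, trace_smul, norm_smul, norm_pow, hμ, one_pow, one_mul,
        trace_units_conj_pow]
    have hlim : Filter.Tendsto (fun N : ℕ => ((overlapTM Ab Ab) ^ N).trace)
        Filter.atTop (nhds (ka : ℂ)) := by
      rw [← hGb'.2.1, charpoly_transfer]
      exact tendsto_trace_pow _ (spectrum_transfer Ab ▸ hGb'.2.2)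
    refine ⟨ka, by simpa [htr] using hlim.norm, Or.inr rfl, fun _ => ⟨?_, rfl, ?_⟩⟩
    · rcases hka with rfl | rfl
      · exact Or.inl ⟨hGa, hGb'⟩
      · exact Or.inr ⟨hGa, hGb'⟩
    · obtain ⟨X, π, hX, hXZ, hπ, hXπ, hπX⟩ := exists_perm_factorization hZa hZb U hYZ
      refine ⟨μ.arg, X, π, hX, hXZ, ?_, fun i => ?_⟩
      · rcases hε with rfl | rfl
        · exact Or.inl (by simpa using hπ)
        · exact Or.inr (by simpa using hπ)
      · have hexp : Complex.exp (μ.arg * Complex.I) = μ := by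
          simpa [hμ] using Complex.norm_mul_exp_arg_mul_I μ
        rw [hexp, hXπ, Matrix.mul_assoc _ _ X⁻¹, hπX, hgauge i]
        simp
end

end FQCA
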